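/- arXiv:1102.1078 — 2 statements merged into one kernel-verified Lean document; each statement's English description precedes it below -/
import Mathlib

section
/- For every a ∈ (0,1/2] and all r, s ∈ (0,1): (1) 𝒦_a(rs) ≤ √(𝒦_a(r²)·𝒦_a(s²)) ≤ (2/π)·𝒦_a(r)·𝒦_a(s), and (2) (2/π)·ℰ_a(r)·ℰ_a(s) ≤ √(ℰ_a(r²)·ℰ_a(s²)) ≤ ℰ_a(rs). -/
open Real Set

/-- Shifted factorial (Pochhammer/Appell symbol) `(a)ₙ`. -/
noncomputable def shiftedFact (a : ℝ) : ℕ → ℝ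
  | 0 => 1
  | n + 1 => shiftedFact a n * (a + n)

/-- Gaussian hypergeometric function `F(a,b;c;x)` as a series. -/
noncomputable def hypF (a b c x : ℝ) : ℝ :=
  ∑' n : ℕ, shiftedFact a n * shiftedFact b n / (shiftedFact c n * (Nat.factorial n : ℝ)) * x ^ n

/-- Generalized complete elliptic integral of the first kind `𝒦ₐ(r)`. -/
noncomputable def ellK (a r : ℝ) : ℝ := (Real.pi / 2) * hypF a (1 - a) 1 (r ^ 2)

/-- Generalized complete elliptic integral of the second kind `ℰₐ(r)`. -/
noncomputable def ellE (a r : ℝ) : ℝ := (Real.pi / 2) * hypF (a - 1) (1 - a) 1 (r ^ 2)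

/-- The generalized Grötzsch modulus `μₐ(r)`. -/
noncomputable def muFn (a r : ℝ) : ℝ :=
  Real.pi / (2 * Real.sin (Real.pi * a)) * ellK a (Real.sqrt (1 - r ^ 2)) / ellK a r

/-- Inverse of `μₐ` (on `(0,1)`, where it is a decreasing homeomorphism onto `(0,∞)`). -/
noncomputable def muInv (a : ℝ) : ℝ → ℝ := Function.invFunOn (muFn a) (Set.Ioo 0 1)

/-- The generalized modular function `φ_K^a(r)`. -/
noncomputable def phiK (a K r : ℝ) : ℝ := muInv a (muFn a r / K)

/-- `η_K^a(x) = (s/s')²` where `s = φ_K^a(√(x/(1+x)))`. -/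
noncomputable def etaK (a K x : ℝ) : ℝ :=
  ((phiK a K (Real.sqrt (x / (1 + x)))) / Real.sqrt (1 - (phiK a K (Real.sqrt (x / (1 + x)))) ^ 2)) ^ 2

/-- `λₐ(K)`. -/
noncomputable def lambdaA (a K : ℝ) : ℝ :=
  (phiK a K (1 / Real.sqrt 2) / phiK a (1 / K) (1 / Real.sqrt 2)) ^ 2

/-- The generalized inverse hyperbolic tangent `artanh_p`. -/
noncomputable def artanhp (p x : ℝ) : ℝ := ∫ t in (0:ℝ)..x, (1 - t ^ p)⁻¹

/-- The inverse hyperbolic tangent. -/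
noncomputable def artanh (x : ℝ) : ℝ := (1 / 2) * Real.log ((1 + x) / (1 - x))

/-- Euler beta function. -/
noncomputable def betaB (x y : ℝ) : ℝ := Real.Gamma x * Real.Gamma y / Real.Gamma (x + y)

/-- `μ_{a,c}(r)`, the two-parameter generalized modulus. -/
noncomputable def muAC (a c r : ℝ) : ℝ :=
  betaB a (c - a) * hypF a (c - a) c (1 - r ^ 2) / (2 * hypF a (c - a) c (r ^ 2))

/-- Inverse of `μ_{a,c}` on `(0,1)`. -/
noncomputable def muACInv (a c : ℝ) : ℝ → ℝ := Function.invFunOn (muAC a c) (Set.Ioo 0 1)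

/-- The modular function `φ_K^{a,c}(r)`. -/
noncomputable def phiAC (a c K r : ℝ) : ℝ := muACInv a c (muAC a c r / K)


lemma sf_one (n : ℕ) : shiftedFact 1 n = (Nat.factorial n : ℝ) := by
  induction n with
  | zero => simp [shiftedFact]
  | succ n ih => rw [shiftedFact, ih, Nat.factorial_succ]; push_cast; ring

lemma sf_nonneg (b : ℝ) (hb : 0 ≤ b) (n : ℕ) : 0 ≤ shiftedFact b n := by
  induction n with
  | zero => simp [shiftedFact]
  | succ n ih => rw [shiftedFact]; positivity

lemma sf_le (b : ℝ) (hb : 0 ≤ b) (hb1 : b ≤ 1) (n : ℕ) :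
    shiftedFact b n ≤ (Nat.factorial n : ℝ) := by
  induction n with
  | zero => simp [shiftedFact]
  | succ n ih =>
    rw [shiftedFact, Nat.factorial_succ]; push_cast
    rw [mul_comm ((n:ℝ)+1)]
    exact mul_le_mul ih (by linarith) (by positivity) (by positivity)

lemma sf_succ (b : ℝ) (n : ℕ) : shiftedFact b (n+1) = b * shiftedFact (b+1) n := by
  induction n with
  | zero => simp [shiftedFact]
  | succ n ih => rw [shiftedFact, ih, shiftedFact]; push_cast; ring

lemma sf_neg (a : ℝ) (h0 : 0 ≤ a) (h1 : a ≤ 1) (n : ℕ) : shiftedFact (a-1) (n+1) ≤ 0 := by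
  rw [sf_succ]
  have := sf_nonneg (a-1+1) (by linarith) n
  nlinarith

lemma sf_neg_abs (a : ℝ) (h0 : 0 ≤ a) (h1 : a ≤ 1) (n : ℕ) :
    |shiftedFact (a-1) n| ≤ (Nat.factorial n : ℝ) := by
  cases n with
  | zero => simp [shiftedFact]
  | succ n =>
    rw [abs_of_nonpos (sf_neg a h0 h1 n), sf_succ]
    have h2 := sf_nonneg (a-1+1) (by linarith) n
    have h3 := sf_le (a-1+1) (by linarith) (by linarith) n
    have h4 : (Nat.factorial n : ℝ) ≤ (Nat.factorial (n+1) : ℝ) := by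
      exact_mod_cast Nat.factorial_le (Nat.le_succ n)
    nlinarith

lemma sf_sum (a : ℝ) (N : ℕ) :
    ∑ n ∈ Finset.range (N+1), shiftedFact (a-1) n / (Nat.factorial n : ℝ)
      = shiftedFact a N / (Nat.factorial N : ℝ) := by
  induction N with
  | zero => simp [shiftedFact]
  | succ N ih =>
    rw [Finset.sum_range_succ, ih, sf_succ, shiftedFact, Nat.factorial_succ]
    have : (Nat.factorial N : ℝ) ≠ 0 := by positivity
    have : (N : ℝ) + 1 ≠ 0 := by positivity
    push_cast
    rw [sub_add_cancel]
    field_simp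
    ring

lemma summ (d : ℕ → ℝ) (hd : ∀ n, |d n| ≤ 1) (x : ℝ) (hx : 0 ≤ x) (hx1 : x < 1) :
    Summable (fun n => d n * x ^ n) := by
  refine Summable.of_norm_bounded (summable_geometric_of_lt_one hx hx1) (fun n => ?_)
  rw [Real.norm_eq_abs, abs_mul, abs_of_nonneg (pow_nonneg hx n)]
  exact mul_le_of_le_one_left (pow_nonneg hx n) (hd n)

lemma partK (d : ℕ → ℝ) (hd0 : ∀ n, 0 ≤ d n) (hd1 : ∀ n, d n ≤ 1) (hd : d 0 = 1)
    (x y : ℝ) (hx : 0 ≤ x) (hx1 : x < 1) (hy : 0 ≤ y) (hy1 : y < 1) (f : ℝ → ℝ)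
    (hf : ∀ x, f x = ∑' n, d n * x ^ n) :
    1 ≤ f x ∧ f (x^2) ≤ f x ∧ f (x*y) ≤ √(f (x^2) * f (y^2)) := by
  have hda : ∀ n, |d n| ≤ 1 := fun n => by rw [abs_of_nonneg (hd0 n)]; exact hd1 n
  have one : ∀ x, 0 ≤ x → x < 1 → 1 ≤ f x := fun x hx hx1 => by
    rw [hf]
    have := (summ d hda x hx hx1).le_tsum 0 (fun n _ => mul_nonneg (hd0 n) (pow_nonneg hx n))
    simpa [hd] using this
  have hx2 : x^2 < 1 := by nlinarith
  have hy2 : y^2 < 1 := by nlinarith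
  refine ⟨one x hx hx1, ?_, ?_⟩
  · rw [hf, hf]
    refine (summ d hda _ (sq_nonneg x) hx2).tsum_le_tsum (fun n => ?_) (summ d hda x hx hx1)
    exact mul_le_mul_of_nonneg_left (pow_le_pow_left₀ (sq_nonneg x) (by nlinarith) n) (hd0 n)
  · have hA := one (x^2) (sq_nonneg x) hx2
    have hB := one (y^2) (sq_nonneg y) hy2
    set p := √(f (x^2)) with hp
    set q := √(f (y^2)) with hq
    have p0 : 0 < p := Real.sqrt_pos.2 (by linarith)
    have q0 : 0 < q := Real.sqrt_pos.2 (by linarith)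
    have pp : p^2 = f (x^2) := Real.sq_sqrt (by linarith)
    have qq : q^2 = f (y^2) := Real.sq_sqrt (by linarith)
    rw [Real.sqrt_mul (by linarith), ← hp, ← hq]
    have s1 := summ d hda _ (sq_nonneg x) hx2
    have s2 := summ d hda _ (sq_nonneg y) hy2
    have s3 := summ d hda (x*y) (mul_nonneg hx hy) (by nlinarith)
    have key : 2*p*q * f (x*y) ≤ q^2 * f (x^2) + p^2 * f (y^2) := by
      rw [hf, hf (x^2), hf (y^2), ← tsum_mul_left, ← tsum_mul_left, ← tsum_mul_left,
        ← (s1.mul_left _).tsum_add (s2.mul_left _)]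
      refine (s3.mul_left _).tsum_le_tsum (fun n => ?_) ((s1.mul_left _).add (s2.mul_left _))
      have := mul_nonneg (hd0 n) (sq_nonneg (q * x^n - p * y^n))
      rw [mul_pow, ← pow_mul, ← pow_mul, mul_comm 2 n, pow_mul, pow_mul]
      nlinarith
    rw [← pp, ← qq] at key
    have : (2*p*q) * f (x*y) ≤ (2*p*q) * (p*q) := by nlinarith
    exact le_of_mul_le_mul_left this (by positivity)

lemma partE (d : ℕ → ℝ) (hd0 : ∀ n, d (n+1) ≤ 0) (hd1 : ∀ n, |d n| ≤ 1) (hd : d 0 = 1)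
    (hs : ∀ N, 0 ≤ ∑ n ∈ Finset.range (N+1), d n)
    (x y : ℝ) (hx : 0 ≤ x) (hx1 : x < 1) (hy : 0 ≤ y) (hy1 : y < 1) (f : ℝ → ℝ)
    (hf : ∀ x, f x = ∑' n, d n * x ^ n) :
    0 ≤ f x ∧ f x ≤ 1 ∧ f x ≤ f (x^2) ∧ f (x^2) + f (y^2) ≤ 2 * f (x*y) := by
  have hx2 : x^2 < 1 := by nlinarith
  have hy2 : y^2 < 1 := by nlinarith
  have s0 := summ d hd1 x hx hx1
  have s1 := summ d hd1 _ (sq_nonneg x) hx2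
  have s2 := summ d hd1 _ (sq_nonneg y) hy2
  have s3 := summ d hd1 (x*y) (mul_nonneg hx hy) (by nlinarith)
  refine ⟨?_, ?_, ?_, ?_⟩
  · rw [hf]
    refine ge_of_tendsto ((Filter.tendsto_add_atTop_iff_nat 1).2 s0.hasSum.tendsto_sum_nat)
      (Filter.Eventually.of_forall fun N => (hs N).trans (Finset.sum_le_sum fun n _ => ?_))
    cases n with
    | zero => simp
    | succ n =>
      have := pow_le_one₀ hx hx1.le (n := n+1)
      nlinarith [hd0 n]
  · rw [hf, s0.tsum_eq_zero_add]
    have : ∑' n, d (n+1) * x^(n+1) ≤ 0 :=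
      tsum_nonpos fun n => mul_nonpos_of_nonpos_of_nonneg (hd0 n) (pow_nonneg hx _)
    simpa [hd] using this
  · rw [hf, hf]
    refine s0.tsum_le_tsum (fun n => ?_) s1
    cases n with
    | zero => simp
    | succ n =>
      exact mul_le_mul_of_nonpos_left
        (pow_le_pow_left₀ (sq_nonneg x) (by nlinarith) (n+1)) (hd0 n)
  · rw [hf, hf (y^2), hf (x*y), ← tsum_mul_left, ← s1.tsum_add s2]
    refine (s1.add s2).tsum_le_tsum (fun n => ?_) (s3.mul_left _)
    cases n with
    | zero => simp; linarith
    | succ n =>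
      have := mul_nonneg (neg_nonneg.2 (hd0 n)) (sq_nonneg (x^(n+1) - y^(n+1)))
      rw [mul_pow, ← pow_mul, ← pow_mul, mul_comm 2 (n+1), pow_mul, pow_mul]
      nlinarith

lemma K_all (a : ℝ) (h0 : 0 ≤ a) (h1 : a ≤ 1)
    (x y : ℝ) (hx : 0 ≤ x) (hx1 : x < 1) (hy : 0 ≤ y) (hy1 : y < 1) :
    1 ≤ hypF a (1-a) 1 x ∧ hypF a (1-a) 1 (x^2) ≤ hypF a (1-a) 1 x ∧
      hypF a (1-a) 1 (x*y) ≤ √(hypF a (1-a) 1 (x^2) * hypF a (1-a) 1 (y^2)) := by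
  refine partK (fun n => shiftedFact a n * shiftedFact (1-a) n /
    (shiftedFact 1 n * (Nat.factorial n : ℝ))) (fun n => ?_) (fun n => ?_) (by simp [shiftedFact])
    x y hx hx1 hy hy1 _ (fun x => rfl)
  · have := sf_nonneg a h0 n
    have := sf_nonneg (1-a) (by linarith) n
    have := sf_nonneg 1 (by linarith) n
    positivity
  · show _ / _ ≤ (1:ℝ)
    rw [sf_one]
    refine div_le_one_of_le₀ ?_ (by positivity)
    exact mul_le_mul (sf_le a h0 h1 n) (sf_le (1-a) (by linarith) (by linarith) n)
      (sf_nonneg _ (by linarith) n) (by positivity)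

lemma E_all (a : ℝ) (h0 : 0 ≤ a) (h1 : a ≤ 1)
    (x y : ℝ) (hx : 0 ≤ x) (hx1 : x < 1) (hy : 0 ≤ y) (hy1 : y < 1) :
    0 ≤ hypF (a-1) (1-a) 1 x ∧ hypF (a-1) (1-a) 1 x ≤ 1 ∧
      hypF (a-1) (1-a) 1 x ≤ hypF (a-1) (1-a) 1 (x^2) ∧
      hypF (a-1) (1-a) 1 (x^2) + hypF (a-1) (1-a) 1 (y^2) ≤ 2 * hypF (a-1) (1-a) 1 (x*y) := by
  have hb0 := sf_nonneg (1-a) (by linarith)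
  have hb1 := sf_le (1-a) (by linarith) (by linarith)
  refine partE (fun n => shiftedFact (a-1) n * shiftedFact (1-a) n /
    (shiftedFact 1 n * (Nat.factorial n : ℝ))) (fun n => ?_) (fun n => ?_) (by simp [shiftedFact])
    (fun N => ?_) x y hx hx1 hy hy1 _ (fun x => rfl)
  · show _ / _ ≤ (0:ℝ)
    rw [sf_one]
    exact div_nonpos_of_nonpos_of_nonneg
      (mul_nonpos_of_nonpos_of_nonneg (sf_neg a h0 h1 n) (hb0 _)) (by positivity)
  · show |_ / _| ≤ (1:ℝ)
    rw [sf_one, abs_div, abs_mul, abs_of_nonneg (hb0 n),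
      abs_of_nonneg (by positivity : (0:ℝ) ≤ (Nat.factorial n : ℝ) * (Nat.factorial n : ℝ))]
    refine div_le_one_of_le₀ ?_ (by positivity)
    exact mul_le_mul (sf_neg_abs a h0 h1 n) (hb1 n) (hb0 n) (by positivity)
  · have h : 0 ≤ shiftedFact a N / (Nat.factorial N : ℝ) :=
      div_nonneg (sf_nonneg a h0 N) (by positivity)
    rw [← sf_sum] at h
    refine h.trans (Finset.sum_le_sum fun n _ => ?_)
    rw [sf_one, mul_div_mul_comm]
    cases n with
    | zero => simp [shiftedFact]
    | succ n =>
      have e1 : shiftedFact (a-1) (n+1) / ((n+1).factorial : ℝ) ≤ 0 :=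
        div_nonpos_of_nonpos_of_nonneg (sf_neg a h0 h1 n) (by positivity)
      have e2 : shiftedFact (1-a) (n+1) / ((n+1).factorial : ℝ) ≤ 1 :=
        div_le_one_of_le₀ (hb1 _) (by positivity)
      nlinarith

theorem stmt5 (a : ℝ) (ha : a ∈ Set.Ioc (0:ℝ) (1/2))
    (r s : ℝ) (hr : r ∈ Set.Ioo (0:ℝ) 1) (hs : s ∈ Set.Ioo (0:ℝ) 1) :
    (ellK a (r * s) ≤ Real.sqrt (ellK a (r ^ 2) * ellK a (s ^ 2)) ∧
      Real.sqrt (ellK a (r ^ 2) * ellK a (s ^ 2)) ≤ 2 / Real.pi * ellK a r * ellK a s) ∧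
    (2 / Real.pi * ellE a r * ellE a s ≤ Real.sqrt (ellE a (r ^ 2) * ellE a (s ^ 2)) ∧
      Real.sqrt (ellE a (r ^ 2) * ellE a (s ^ 2)) ≤ ellE a (r * s)) := by
  obtain ⟨ha0, ha1⟩ := ha
  obtain ⟨hr0, hr1⟩ := hr
  obtain ⟨hs0, hs1⟩ := hs
  have hx1 : r^2 < 1 := by nlinarith
  have hy1 : s^2 < 1 := by nlinarith
  have hK := K_all a ha0.le (by linarith) (r^2) (s^2) (sq_nonneg r) hx1 (sq_nonneg s) hy1
  have hK' := K_all a ha0.le (by linarith) (s^2) (r^2) (sq_nonneg s) hy1 (sq_nonneg r) hx1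
  have hE := E_all a ha0.le (by linarith) (r^2) (s^2) (sq_nonneg r) hx1 (sq_nonneg s) hy1
  have hE' := E_all a ha0.le (by linarith) (s^2) (r^2) (sq_nonneg s) hy1 (sq_nonneg r) hx1
  have hK3 := (K_all a ha0.le (by linarith) ((r^2)^2) 0 (by positivity) (by nlinarith [sq_nonneg r]) le_rfl one_pos).1
  have pi0 := Real.pi_pos
  have sq : ∀ u v : ℝ, √((π/2*u)*(π/2*v)) = π/2 * √(u*v) := fun u v => by
    rw [show (π/2*u)*(π/2*v) = (π/2)^2*(u*v) by ring, Real.sqrt_mul (by positivity),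
      Real.sqrt_sq (by positivity)]
  have pr : ∀ u v : ℝ, 2/π*(π/2*u)*(π/2*v) = π/2*(u*v) := fun u v => by
    field_simp
  unfold ellK ellE
  rw [sq, sq, pr, pr, mul_pow]
  generalize hypF a (1-a) 1 (r^2) = k1 at *
  generalize hypF a (1-a) 1 (s^2) = k2 at *
  generalize hypF a (1-a) 1 ((r^2)^2) = k3 at *
  generalize hypF a (1-a) 1 ((s^2)^2) = k4 at *
  generalize hypF (a-1) (1-a) 1 (r^2) = e1 at *
  generalize hypF (a-1) (1-a) 1 (s^2) = e2 at *
  generalize hypF (a-1) (1-a) 1 ((r^2)^2) = e3 at *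
  generalize hypF (a-1) (1-a) 1 ((s^2)^2) = e4 at *
  obtain ⟨a1, a2, a3⟩ := hK
  obtain ⟨b1, b2, -⟩ := hK'
  obtain ⟨c1, c2, c3, c4⟩ := hE
  obtain ⟨d1, d2, d3, -⟩ := hE'
  have hp : 0 ≤ π/2 := by positivity
  refine ⟨⟨mul_le_mul_of_nonneg_left a3 hp, mul_le_mul_of_nonneg_left ?_ hp⟩,
    mul_le_mul_of_nonneg_left ?_ hp, mul_le_mul_of_nonneg_left ?_ hp⟩
  · have h1 : 1 ≤ k1 * k2 := by nlinarith
    refine Real.sqrt_le_iff.2 ⟨by linarith, ?_⟩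
    have : k3 * k4 ≤ k1 * k2 :=
      (mul_le_mul_of_nonneg_left b2 (by linarith)).trans
        (mul_le_mul_of_nonneg_right a2 (by linarith))
    nlinarith
  · refine Real.le_sqrt_of_sq_le ?_
    have : e1 * e2 ≤ e3 * e4 := mul_le_mul c3 d3 d1 (by linarith)
    have h0 : 0 ≤ e1 * e2 := mul_nonneg c1 d1
    have h1 : e1 * e2 ≤ 1 := mul_le_one₀ c2 d1 d2
    nlinarith
  · refine Real.sqrt_le_iff.2 ⟨by linarith, ?_⟩
    nlinarith [sq_nonneg (e3 - e4)]
end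

section
/- For a ∈ (0,1/2], K ≥ 1, p ≥ 1 and all r, s ∈ (0,1): (φ_K^a(r^p)^{1/p} + φ_K^a(s^p)^{1/p})/(1 + φ_K^a(r^p)^{1/p}·φ_K^a(s^p)^{1/p}) ≤ (φ_K^a(r) + φ_K^a(s))/(1 + φ_K^a(r)·φ_K^a(s)) ≤ (φ_K^a(r^{1/p})^p + φ_K^a(s^{1/p})^p)/(1 + (φ_K^a(r^{1/p})·φ_K^a(s^{1/p}))^p). -/
open Real Set

/-- coefficients -/
noncomputable def hcoef (a : ℝ) (n : ℕ) : ℝ :=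
  shiftedFact a n * shiftedFact (1 - a) n / (shiftedFact 1 n * (Nat.factorial n : ℝ))

lemma shiftedFact_pos {a : ℝ} (ha : 0 < a) (n : ℕ) : 0 < shiftedFact a n := by
  induction n with
  | zero => simp [shiftedFact]
  | succ n ih => simp only [shiftedFact]; positivity

lemma hcoef_pos {a : ℝ} (ha : 0 < a) (ha' : a < 1) (n : ℕ) : 0 < hcoef a n := by
  have h1 := shiftedFact_pos ha n
  have h2 := shiftedFact_pos (sub_pos.2 ha') n
  have h3 := shiftedFact_pos one_pos n
  unfold hcoef
  positivity

lemma hcoef_zero (a : ℝ) : hcoef a 0 = 1 := by simp [hcoef, shiftedFact]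

lemma hcoef_succ (a : ℝ) (n : ℕ) :
    hcoef a (n + 1) * ((n:ℝ) + 1) ^ 2 = hcoef a n * ((n:ℝ) ^ 2 + n + a * (1 - a)) := by
  have h3 := (shiftedFact_pos one_pos n).ne'
  have h4 : ((n:ℝ) + 1) ≠ 0 := by positivity
  have h5 : (1 + (n:ℝ)) ≠ 0 := by positivity
  have h6 : (Nat.factorial n : ℝ) ≠ 0 := by positivity
  unfold hcoef
  simp only [shiftedFact, Nat.factorial_succ]
  push_cast
  field_simp
  ring

lemma hcoef_dec {a : ℝ} (ha : 0 < a) (ha' : a < 1) (n : ℕ) :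
    ((n + 1 : ℕ) + 1 : ℝ) * hcoef a (n + 1) ≤ ((n:ℝ) + 1) * hcoef a n := by
  have h := hcoef_succ a n
  have hc := hcoef_pos ha ha' n
  have h4 : 0 < ((n:ℝ) + 1) := by positivity
  have hn : (0:ℝ) ≤ n := by positivity
  have hb : a * (1 - a) ≤ 1 / 4 := by nlinarith [sq_nonneg (a - 1/2)]
  have : ((n + 1 : ℕ) + 1 : ℝ) * hcoef a (n + 1) * ((n:ℝ) + 1) ^ 2
      ≤ ((n:ℝ) + 1) * hcoef a n * ((n:ℝ) + 1) ^ 2 := by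
    push_cast
    rw [mul_assoc, h]
    have : ((n:ℝ) + 1 + 1) * ((n:ℝ) ^ 2 + n + a * (1 - a)) ≤ ((n:ℝ) + 1) ^ 3 := by nlinarith
    calc _ = hcoef a n * (((n:ℝ) + 1 + 1) * ((n:ℝ) ^ 2 + n + a * (1 - a))) := by ring
      _ ≤ hcoef a n * ((n:ℝ) + 1) ^ 3 := by gcongr
      _ = _ := by ring
  exact le_of_mul_le_mul_right this (by positivity)

lemma hcoef_anti {a : ℝ} (ha : 0 < a) (ha' : a < 1) :
    Antitone (fun n : ℕ => ((n:ℝ) + 1) * hcoef a n) :=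
  antitone_nat_of_succ_le (hcoef_dec ha ha')

lemma hcoef_le_one {a : ℝ} (ha : 0 < a) (ha' : a < 1) (n : ℕ) : hcoef a n ≤ 1 := by
  have h := hcoef_anti ha ha' (Nat.zero_le n)
  simp only [hcoef_zero] at h
  have hc := hcoef_pos ha ha' n
  have hn : (0:ℝ) ≤ n := by positivity
  norm_num at h
  nlinarith

lemma hcoef_lower {a : ℝ} (ha : 0 < a) (ha' : a < 1) (n : ℕ) :
    a * (1 - a) ≤ ((n:ℝ) + 1) * hcoef a (n + 1) := by
  induction n with
  | zero => have := hcoef_succ a 0; simp [hcoef_zero] at this; simp [this]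
  | succ n ih =>
    refine ih.trans ?_
    have h := hcoef_succ a (n + 1)
    have hc := hcoef_pos ha ha' (n + 1)
    have hn : (0:ℝ) ≤ n := by positivity
    have hb : 0 < a * (1 - a) := mul_pos ha (by linarith)
    push_cast at h ⊢
    refine le_of_mul_le_mul_right (a := (n:ℝ) + 1 + 1) ?_ (by positivity)
    calc ((n:ℝ) + 1) * hcoef a (n + 1) * ((n:ℝ) + 1 + 1)
        ≤ hcoef a (n + 1) * (((n:ℝ) + 1) ^ 2 + ((n:ℝ) + 1) + a * (1 - a)) := by nlinarith
      _ = _ := by rw [← h]; ring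

/-- general power series derivative -/
lemma ps_summable {c : ℕ → ℝ} (k : ℕ) (hc : ∀ n, |c n| ≤ (n:ℝ) ^ k + 1) {x : ℝ} (hx : |x| < 1) :
    Summable (fun n => c n * x ^ n) := by
  have h1 : Summable (fun n : ℕ => (n:ℝ) ^ k * |x| ^ n) :=
    summable_pow_mul_geometric_of_norm_lt_one k (by simpa using hx)
  have h2 : Summable (fun n : ℕ => |x| ^ n) := summable_geometric_of_lt_one (abs_nonneg _) hx
  refine Summable.of_norm_bounded (h1.add h2) (fun n => ?_)
  rw [Real.norm_eq_abs, abs_mul, abs_pow, ← add_one_mul]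
  gcongr
  exact hc n

lemma ps_deriv {c : ℕ → ℝ} (k : ℕ) (hc : ∀ n, |c n| ≤ (n:ℝ) ^ k + 1) {x : ℝ} (hx : |x| < 1) :
    HasDerivAt (fun t => ∑' n, c n * t ^ n) (∑' n : ℕ, c n * (n * x ^ (n - 1))) x := by
  obtain ⟨ρ, h1, h2⟩ := exists_between hx
  have hρ : 0 < ρ := (abs_nonneg x).trans_lt h1
  have hs : Summable (fun n : ℕ => ((n:ℝ) ^ k + 1) * (n * ρ ^ (n - 1))) := by
    have e1 : Summable (fun n : ℕ => (n:ℝ) ^ (k + 1) * ρ ^ n) :=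
      summable_pow_mul_geometric_of_norm_lt_one _ (by simpa [abs_of_pos hρ] using h2)
    have e2 : Summable (fun n : ℕ => (n:ℝ) ^ 1 * ρ ^ n) :=
      summable_pow_mul_geometric_of_norm_lt_one _ (by simpa [abs_of_pos hρ] using h2)
    refine ((e1.add e2).mul_left ρ⁻¹).congr (fun n => ?_)
    cases n with
    | zero => simp
    | succ n => simp only [Nat.add_sub_cancel]; field_simp; ring
  refine hasDerivAt_tsum_of_isPreconnected (t := Set.Ioo (-ρ) ρ) (y₀ := 0) hs isOpen_Ioo
    (convex_Ioo _ _).isPreconnected (g := fun n t => c n * t ^ n)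
    (g' := fun n t => c n * (n * t ^ (n - 1))) (fun n y _ => (hasDerivAt_pow n y).const_mul _)
    (fun n y hy => ?_) (by simp [hρ]) ?_ (abs_lt.1 h1)
  · rw [Real.norm_eq_abs, abs_mul, abs_mul, abs_pow, Nat.abs_cast]
    have := (abs_lt.2 hy).le
    gcongr
    exact hc n
  · exact ps_summable k hc (by simp)

lemma ps_shift (c : ℕ → ℝ) (x : ℝ) :
    x * (∑' n : ℕ, c n * (n * x ^ (n - 1))) = ∑' n : ℕ, (c n * n) * x ^ n := by
  rw [← tsum_mul_left]
  congr 1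
  ext n
  cases n with
  | zero => simp
  | succ n => simp only [Nat.add_sub_cancel]; ring

/-- the function F(t) -/
noncomputable def hF (a t : ℝ) : ℝ := ∑' n, hcoef a n * t ^ n

noncomputable def hF' (a t : ℝ) : ℝ := ∑' n : ℕ, hcoef a n * (n * t ^ (n - 1))

noncomputable def hP (a t : ℝ) : ℝ := ∑' n : ℕ, (hcoef a n * n) * t ^ n

section
variable {a : ℝ} (ha : 0 < a) (ha' : a < 1)
include ha ha'

lemma hb0 (n : ℕ) : |hcoef a n| ≤ (n:ℝ) ^ 0 + 1 := by
  rw [abs_of_pos (hcoef_pos ha ha' n)]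
  have := hcoef_le_one ha ha' n
  norm_num; linarith

lemma hb1 (n : ℕ) : |hcoef a n * n| ≤ (n:ℝ) ^ 1 + 1 := by
  rw [abs_of_nonneg (mul_nonneg (hcoef_pos ha ha' n).le (by positivity))]
  have := mul_le_mul_of_nonneg_right (hcoef_le_one ha ha' n) (Nat.cast_nonneg (α := ℝ) n)
  simp at this ⊢; linarith

lemma hb2 (n : ℕ) : |hcoef a n * n * n| ≤ (n:ℝ) ^ 2 + 1 := by
  rw [abs_of_nonneg (mul_nonneg (mul_nonneg (hcoef_pos ha ha' n).le (by positivity)) (by positivity))]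
  have := mul_le_mul_of_nonneg_right (hcoef_le_one ha ha' n) (sq_nonneg (n:ℝ))
  nlinarith

lemma hF_deriv {t : ℝ} (ht : |t| < 1) : HasDerivAt (hF a) (hF' a t) t :=
  ps_deriv 0 (hb0 ha ha') ht

omit ha ha' in
lemma hP_eq (t : ℝ) : hP a t = t * hF' a t := (ps_shift _ _).symm

/-- the ODE -/
lemma hP_deriv {t : ℝ} (ht : |t| < 1) :
    HasDerivAt (fun t => (1 - t) * hP a t) (a * (1 - a) * hF a t) t := by
  have h := ps_deriv 1 (hb1 ha ha') ht
  have h2 := ((hasDerivAt_id t).const_sub 1).mul h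
  refine h2.congr_deriv ?_
  have s0 := ps_summable 0 (hb0 ha ha') ht
  have s1 := ps_summable 1 (hb1 ha ha') ht
  have s2 := ps_summable 2 (hb2 ha ha') ht
  have e1 := ps_shift (fun n => hcoef a n * n) t
  have e2 : ∑' n : ℕ, (hcoef a n * n) * (n * t ^ (n - 1))
      = ∑' n : ℕ, (hcoef a n * n * n) * t ^ n + ∑' n : ℕ, (hcoef a n * n) * t ^ n
        + a * (1 - a) * ∑' n : ℕ, hcoef a n * t ^ n := by
    rw [← tsum_mul_left, ← s2.tsum_add s1, ← (s2.add s1).tsum_add (s0.mul_left _)]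
    have hz : (fun n : ℕ => hcoef a (n+1) * ((n+1 : ℕ):ℝ) * (((n+1 : ℕ):ℝ) * t ^ (n + 1 - 1)))
        = fun n : ℕ => hcoef a n * n * n * t ^ n + hcoef a n * n * t ^ n
          + a * (1 - a) * (hcoef a n * t ^ n) := by
      ext n
      have := hcoef_succ a n
      simp only [Nat.add_sub_cancel]
      push_cast
      linear_combination t ^ n * this
    have hs : Summable (fun n : ℕ => (hcoef a n * n) * (n * t ^ (n - 1))) := by
      rw [← summable_nat_add_iff 1, hz]
      exact (s2.add s1).add (s0.mul_left _)
    rw [hs.tsum_eq_zero_add, hz]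
    simp
  simp only [id]
  unfold hF
  linear_combination e2 - e1

lemma hF_strictMono : StrictMonoOn (hF a) (Set.Ico 0 1) := by
  intro x hx y hy hxy
  have s := ps_summable 0 (hb0 ha ha') (x := x) (by rw [abs_of_nonneg hx.1]; exact hx.2)
  have s' := ps_summable 0 (hb0 ha ha') (x := y) (by rw [abs_of_nonneg hy.1]; exact hy.2)
  refine Summable.tsum_lt_tsum (i := 1) (fun n => ?_) ?_ s s'
  · exact mul_le_mul_of_nonneg_left (pow_le_pow_left₀ hx.1 hxy.le n) (hcoef_pos ha ha' n).le
  · simpa using mul_lt_mul_of_pos_left hxy (hcoef_pos ha ha' 1)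

lemma hF_ge_one {t : ℝ} (ht : t ∈ Set.Ico (0:ℝ) 1) : 1 ≤ hF a t := by
  have h0 : hF a 0 = 1 := by
    unfold hF
    rw [tsum_eq_single 0 (fun n hn => by simp [hn])]
    simp [hcoef_zero]
  rw [← h0]
  exact (hF_strictMono ha ha').monotoneOn (by simp) ht ht.1

lemma hF'_nonneg {t : ℝ} (ht : 0 ≤ t) : 0 ≤ hF' a t :=
  tsum_nonneg fun n => mul_nonneg (hcoef_pos ha ha' n).le (by positivity)

lemma hF_lower {t : ℝ} (ht : t ∈ Set.Ico (0:ℝ) 1) : a * (1 - a) * (-Real.log (1 - t)) ≤ hF a t := by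
  have ht' : |t| < 1 := by rw [abs_of_nonneg ht.1]; exact ht.2
  have h := Real.hasSum_pow_div_log_of_abs_lt_one ht'
  have s := ps_summable 0 (hb0 ha ha') ht'
  unfold hF
  rw [s.tsum_eq_zero_add, ← h.tsum_eq, ← tsum_mul_left]
  have := Summable.tsum_le_tsum (f := fun n : ℕ => a * (1 - a) * (t ^ (n + 1) / ((n:ℝ) + 1)))
    (g := fun n : ℕ => hcoef a (n + 1) * t ^ (n + 1)) (fun n => ?_) (h.summable.mul_left _)
    ((summable_nat_add_iff 1).2 s)
  · simp [hcoef_zero]; linarith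
  · have h1 := hcoef_lower ha ha' n
    have h2 : 0 ≤ t ^ (n + 1) := pow_nonneg ht.1 _
    have h3 : (0:ℝ) < n + 1 := by positivity
    calc a * (1 - a) * (t ^ (n + 1) / ((n:ℝ) + 1))
        ≤ (((n:ℝ) + 1) * hcoef a (n + 1)) * (t ^ (n + 1) / ((n:ℝ) + 1)) := by gcongr
      _ = _ := by field_simp

/-- ratio monotonicity, finite version -/
lemma ratio_fin {u v : ℝ} (hu : 0 < u) (huv : u ≤ v) (N : ℕ) :
    (∑ n ∈ Finset.range N, hcoef a n * v ^ n) * (∑ n ∈ Finset.range N, u ^ n / ((n:ℝ) + 1)) ≤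
    (∑ n ∈ Finset.range N, hcoef a n * u ^ n) * (∑ n ∈ Finset.range N, v ^ n / ((n:ℝ) + 1)) := by
  have hv := hu.trans_le huv
  induction N with
  | zero => simp
  | succ N ih =>
    simp only [Finset.sum_range_succ]
    have key : 0 ≤ ∑ n ∈ Finset.range N, ((hcoef a n * (1 / ((N:ℝ) + 1)) - hcoef a N * (1 / ((n:ℝ) + 1))) *
        (u ^ n * v ^ N - v ^ n * u ^ N)) := by
      refine Finset.sum_nonneg fun n hn => mul_nonneg ?_ ?_
      · have := hcoef_anti ha ha' (Finset.mem_range.1 hn).le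
        simp only at this
        rw [sub_nonneg, mul_one_div, mul_one_div, div_le_div_iff₀ (by positivity) (by positivity)]
        linarith
      · obtain ⟨k, rfl⟩ := Nat.exists_eq_add_of_le (Finset.mem_range.1 hn).le
        have := pow_le_pow_left₀ hu.le huv k
        have h2 : 0 ≤ u ^ n * v ^ n := by positivity
        rw [pow_add, pow_add]
        nlinarith
    have e : ∑ n ∈ Finset.range N, ((hcoef a n * (1 / ((N:ℝ) + 1)) - hcoef a N * (1 / ((n:ℝ) + 1))) *
        (u ^ n * v ^ N - v ^ n * u ^ N)) =
        (∑ n ∈ Finset.range N, hcoef a n * u ^ n) * (v ^ N / ((N:ℝ) + 1))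
        - (∑ n ∈ Finset.range N, hcoef a n * v ^ n) * (u ^ N / ((N:ℝ) + 1))
        - hcoef a N * v ^ N * (∑ n ∈ Finset.range N, u ^ n / ((n:ℝ) + 1))
        + hcoef a N * u ^ N * (∑ n ∈ Finset.range N, v ^ n / ((n:ℝ) + 1)) := by
      simp only [Finset.sum_mul, Finset.mul_sum, ← Finset.sum_sub_distrib, ← Finset.sum_add_distrib]
      refine Finset.sum_congr rfl fun n _ => ?_
      ring
    rw [e] at key
    have e3 : hcoef a N * v ^ N * (u ^ N / ((N:ℝ) + 1)) = hcoef a N * u ^ N * (v ^ N / ((N:ℝ) + 1)) := by ring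
    nlinarith

/-- `L(u) = -log(1-u)/u` -/
lemma ratio_mono {u v : ℝ} (hu : 0 < u) (huv : u ≤ v) (hv : v < 1) :
    (-Real.log (1 - u) / u) / hF a u ≤ (-Real.log (1 - v) / v) / hF a v := by
  have hL : ∀ x : ℝ, 0 < x → x < 1 → HasSum (fun n : ℕ => x ^ n / ((n:ℝ) + 1)) (-Real.log (1 - x) / x) := by
    intro x h0 h1
    have h := (Real.hasSum_pow_div_log_of_abs_lt_one (x := x) (by rw [abs_of_pos h0]; exact h1)).div_const x
    have e : (fun n : ℕ => x ^ n / ((n:ℝ) + 1)) = fun n : ℕ => x ^ (n + 1) / ((n:ℝ) + 1) / x := by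
      ext n
      rw [pow_succ]
      field_simp
    rw [e]
    exact h
  have hFs : ∀ x : ℝ, 0 < x → x < 1 → HasSum (fun n : ℕ => hcoef a n * x ^ n) (hF a x) := by
    intro x h0 h1
    exact (ps_summable 0 (hb0 ha ha') (by rw [abs_of_pos h0]; exact h1)).hasSum
  have hv0 := hu.trans_le huv
  have hu1 := huv.trans_lt hv
  rw [div_le_div_iff₀ (zero_lt_one.trans_le (hF_ge_one ha ha' ⟨hu.le, hu1⟩))
    (zero_lt_one.trans_le (hF_ge_one ha ha' ⟨hv0.le, hv⟩))]
  have := le_of_tendsto_of_tendsto'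
    ((hFs v hv0 hv).tendsto_sum_nat.mul (hL u hu hu1).tendsto_sum_nat)
    ((hFs u hu hu1).tendsto_sum_nat.mul (hL v hv0 hv).tendsto_sum_nat) (ratio_fin ha ha' hu huv)
  linarith

end
section
variable {a : ℝ} (ha : 0 < a) (ha' : a < 1)
include ha ha'

lemma wronskian : ∃ C : ℝ, 0 ≤ C ∧ ∀ t ∈ Set.Ioo (0:ℝ) 1,
    t * (1 - t) * (hF' a t * hF a (1 - t) + hF a t * hF' a (1 - t)) = C := by
  set W : ℝ → ℝ := fun t => (1 - t) * hP a t * hF a (1 - t) +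
    hF a t * ((1 - (1 - t)) * hP a (1 - t)) with hW
  have hWe : ∀ t, W t = t * (1 - t) * (hF' a t * hF a (1 - t) + hF a t * hF' a (1 - t)) := by
    intro t
    simp only [hW, hP_eq]
    ring
  have hd : ∀ t ∈ Set.Ioo (0:ℝ) 1, HasDerivAt W 0 t := by
    intro t ht
    have ht1 : |t| < 1 := abs_lt.2 ⟨by linarith [ht.1], ht.2⟩
    have ht2 : |1 - t| < 1 := abs_lt.2 ⟨by linarith [ht.2], by linarith [ht.1]⟩
    have hi : HasDerivAt (fun t : ℝ => 1 - t) (-1) t := (hasDerivAt_id t).const_sub 1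
    have h1 := hP_deriv ha ha' ht1
    have h2 := hF_deriv ha ha' ht1
    have h3 := (hP_deriv ha ha' ht2).comp t hi
    have h4 := (hF_deriv ha ha' ht2).comp t hi
    have := (h1.mul h4).add (h2.mul h3)
    refine this.congr_deriv ?_
    simp only [Function.comp, hP_eq]
    ring
  refine ⟨W (1/2), ?_, fun t ht => ?_⟩
  · rw [hWe]
    have h1 : 1 ≤ hF a (1/2) := hF_ge_one ha ha' ⟨by norm_num, by norm_num⟩
    have h2 : 0 ≤ hF' a (1/2) := hF'_nonneg ha ha' (by norm_num)
    have e : (1:ℝ) - 1/2 = 1/2 := by norm_num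
    rw [e]
    positivity
  · rw [← hWe]
    exact isOpen_Ioo.is_const_of_deriv_eq_zero (convex_Ioo _ _).isPreconnected
      (fun x hx => (hd x hx).differentiableAt.differentiableWithinAt)
      (fun x hx => (hd x hx).deriv) ht ⟨by norm_num, by norm_num⟩

/-- log of the modulus in exponential coordinates -/
lemma logmod : ∃ q : ℝ → ℝ, MonotoneOn q (Set.Ioi 0) ∧ ∀ x ∈ Set.Ioi (0:ℝ),
    HasDerivAt (fun x => Real.log (hF a (1 - Real.exp (-x))) - Real.log (hF a (Real.exp (-x))))
      (q x / x) x := by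
  obtain ⟨C, hC, hW⟩ := wronskian ha ha'
  have hpos : ∀ t ∈ Set.Ioo (0:ℝ) 1, 0 < hF a t := fun t ht =>
    zero_lt_one.trans_le (hF_ge_one ha ha' ⟨ht.1.le, ht.2⟩)
  have hex : ∀ x ∈ Set.Ioi (0:ℝ), Real.exp (-x) ∈ Set.Ioo (0:ℝ) 1 := fun x hx =>
    ⟨Real.exp_pos _, by rw [← Real.exp_zero]; exact Real.exp_lt_exp.2 (by simpa using hx)⟩
  refine ⟨fun x => C * ((-Real.log (1 - (1 - Real.exp (-x))) / (1 - Real.exp (-x))) /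
    hF a (1 - Real.exp (-x)) * (1 / hF a (Real.exp (-x)))), ?_, ?_⟩
  · intro x hx y hy hxy
    have h1 := hex x hx
    have h2 := hex y hy
    have h3 : Real.exp (-y) ≤ Real.exp (-x) := Real.exp_le_exp.2 (by linarith)
    have hm := ratio_mono ha ha' (u := 1 - Real.exp (-x)) (v := 1 - Real.exp (-y))
      (by linarith [h1.2]) (by linarith) (by linarith [h2.1])
    have hFm := (hF_strictMono ha ha').monotoneOn ⟨h2.1.le, h2.2⟩ ⟨h1.1.le, h1.2⟩ h3
    have hp1 := hpos _ h1
    have hp2 := hpos _ h2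
    have hp3 := hpos (1 - Real.exp (-y)) ⟨by linarith [h2.2], by linarith [h2.1]⟩
    refine mul_le_mul_of_nonneg_left (mul_le_mul hm (one_div_le_one_div_of_le hp2 hFm)
      (by positivity) ?_) hC
    have e : -Real.log (1 - (1 - Real.exp (-y))) = y := by simp
    rw [e]
    have : 0 < 1 - Real.exp (-y) := by linarith [h2.2]
    have : (0:ℝ) < y := hy
    positivity
  · intro x hx
    have h1 := hex x hx
    have hx0 : (0:ℝ) < x := hx
    have he : HasDerivAt (fun x : ℝ => Real.exp (-x)) (-Real.exp (-x)) x := by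
      simpa using (hasDerivAt_neg x).exp
    have hWx := hW _ h1
    have e : -Real.log (1 - (1 - Real.exp (-x))) = x := by simp
    simp only [e]
    set t := Real.exp (-x) with ht
    have hu : 1 - t ∈ Set.Ioo (0:ℝ) 1 := ⟨by linarith [h1.2], by linarith [h1.1]⟩
    have hp1 := hpos _ h1
    have hp3 := hpos _ hu
    have ht1 : |t| < 1 := abs_lt.2 ⟨by linarith [h1.1], h1.2⟩
    have ht2 : |1 - t| < 1 := abs_lt.2 ⟨by linarith [hu.1], hu.2⟩
    have d1 := HasDerivAt.log (f := fun x => hF a (Real.exp (-x))) 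
      (HasDerivAt.comp (h₂ := hF a) (h := fun x => Real.exp (-x)) x (hF_deriv ha ha' ht1) he) hp1.ne'
    have d2 := HasDerivAt.log (f := fun x => hF a (1 - Real.exp (-x)))
      (HasDerivAt.comp (h₂ := hF a) (h := fun x => 1 - Real.exp (-x)) x (hF_deriv ha ha' ht2) (he.const_sub 1)) hp3.ne'
    refine (d2.sub d1).congr_deriv ?_
    rw [← hWx, ← ht]
    have := hu.1.ne'
    field_simp
    ring

lemma logmod_ineq {p x y : ℝ} (hp : 1 ≤ p) (hy : 0 < y) (hyx : y ≤ x) (Q : ℝ → ℝ)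
    (hQ : Q = fun x => Real.log (hF a (1 - Real.exp (-x))) - Real.log (hF a (Real.exp (-x)))) :
    Q (p * y) - Q y ≤ Q (p * x) - Q x := by
  obtain ⟨q, hq, hd⟩ := logmod ha ha'
  rw [← hQ] at hd
  have hp0 : 0 < p := by linarith
  have hd2 : ∀ x ∈ Set.Ioi (0:ℝ), HasDerivAt (fun x => Q (p * x) - Q x)
      (q (p * x) / (p * x) * p - q x / x) x := by
    intro x hx
    have hl : HasDerivAt (fun x : ℝ => p * x) p x := by simpa using (hasDerivAt_id x).const_mul p
    exact ((hd (p * x) (mul_pos hp0 hx)).comp x hl).sub (hd x hx)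
  refine monotoneOn_of_deriv_nonneg (convex_Ioi (0:ℝ)) (f := fun x => Q (p * x) - Q x)
    (fun x hx => (hd2 x hx).continuousAt.continuousWithinAt) ?_ ?_ hy (hy.trans_le hyx) hyx
  · rw [interior_Ioi]
    exact fun x hx => (hd2 x hx).differentiableAt.differentiableWithinAt
  · rw [interior_Ioi]
    intro x hx
    have hx0 : (0:ℝ) < x := hx
    rw [(hd2 x hx).deriv]
    have h1 : q x ≤ q (p * x) := hq hx (mul_pos hp0 hx0) (by nlinarith)
    have : q (p * x) / (p * x) * p - q x / x = (q (p * x) - q x) / x := by field_simp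
    rw [this]
    exact div_nonneg (by linarith) hx0.le

omit ha ha' in
lemma muFn_eq {r : ℝ} (hr : r ∈ Set.Ioo (0:ℝ) 1) :
    muFn a r = Real.pi / (2 * Real.sin (Real.pi * a)) * (hF a (1 - r ^ 2) / hF a (r ^ 2)) := by
  have h0 : 0 ≤ 1 - r ^ 2 := by nlinarith [hr.1, hr.2]
  have e : ∀ t, hypF a (1 - a) 1 t = hF a t := fun t => rfl
  unfold muFn ellK
  rw [Real.sq_sqrt h0, e, e, mul_div_assoc, mul_div_mul_left _ _ (by positivity)]

lemma muConst_pos : 0 < Real.pi / (2 * Real.sin (Real.pi * a)) := by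
  have : 0 < Real.sin (Real.pi * a) :=
    Real.sin_pos_of_pos_of_lt_pi (by positivity) (by nlinarith [Real.pi_pos])
  positivity

omit ha ha' in
lemma sq_mem {r : ℝ} (hr : r ∈ Set.Ioo (0:ℝ) 1) :
    r ^ 2 ∈ Set.Ioo (0:ℝ) 1 ∧ 1 - r ^ 2 ∈ Set.Ioo (0:ℝ) 1 := by
  have := hr.1
  have := hr.2
  refine ⟨⟨?_, ?_⟩, ?_, ?_⟩ <;> nlinarith

lemma hF_pos {t : ℝ} (ht : t ∈ Set.Ioo (0:ℝ) 1) : 0 < hF a t :=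
  zero_lt_one.trans_le (hF_ge_one ha ha' ⟨ht.1.le, ht.2⟩)

lemma muFn_pos {r : ℝ} (hr : r ∈ Set.Ioo (0:ℝ) 1) : 0 < muFn a r := by
  rw [muFn_eq hr]
  have h1 := hF_pos ha ha' (sq_mem hr).1
  have h2 := hF_pos ha ha' (sq_mem hr).2
  have h3 := muConst_pos ha ha'
  exact mul_pos h3 (div_pos h2 h1)

lemma muFn_anti : StrictAntiOn (muFn a) (Set.Ioo 0 1) := by
  intro r hr s hs hrs
  rw [muFn_eq hr, muFn_eq hs]
  obtain ⟨r1, r2⟩ := sq_mem hr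
  obtain ⟨s1, s2⟩ := sq_mem hs
  have hsq : r ^ 2 < s ^ 2 := by nlinarith [hr.1, hs.1]
  have m1 := hF_strictMono ha ha' ⟨r1.1.le, r1.2⟩ ⟨s1.1.le, s1.2⟩ hsq
  have m2 := hF_strictMono ha ha' ⟨s2.1.le, s2.2⟩ ⟨r2.1.le, r2.2⟩ (by linarith : 1 - s ^ 2 < 1 - r ^ 2)
  refine mul_lt_mul_of_pos_left ?_ (muConst_pos ha ha')
  exact div_lt_div₀ m2 m1.le (hF_pos ha ha' r2).le (hF_pos ha ha' r1)

lemma muFn_cont : ContinuousOn (muFn a) (Set.Ioo 0 1) := by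
  have hc : ∀ t ∈ Set.Ioo (0:ℝ) 1, ContinuousAt (hF a) t := fun t ht =>
    (hF_deriv ha ha' (abs_lt.2 ⟨by linarith [ht.1], ht.2⟩)).continuousAt
  refine ContinuousOn.congr ?_ (fun r hr => muFn_eq hr)
  intro r hr
  obtain ⟨r1, r2⟩ := sq_mem hr
  refine ContinuousAt.continuousWithinAt ?_
  refine continuousAt_const.mul (ContinuousAt.div ?_ ?_ (hF_pos ha ha' r1).ne')
  · exact ContinuousAt.comp (f := fun r : ℝ => 1 - r ^ 2) (hc _ r2) (by fun_prop)
  · exact ContinuousAt.comp (f := fun r : ℝ => r ^ 2) (hc _ r1) (by fun_prop)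

lemma muFn_exists {r y : ℝ} (hr : r ∈ Set.Ioo (0:ℝ) 1) (hy : 0 < y) (hyr : y ≤ muFn a r) :
    ∃ s ∈ Set.Ioo (0:ℝ) 1, muFn a s = y := by
  obtain ⟨r1, r2⟩ := sq_mem hr
  have hk := muConst_pos ha ha'
  set k := Real.pi / (2 * Real.sin (Real.pi * a)) with hkd
  have hb : 0 < a * (1 - a) := mul_pos ha (by linarith)
  have hFr := hF_pos ha ha' r2
  -- choose t
  set A := k * hF a (1 - r ^ 2) / y / (a * (1 - a)) with hA
  have hA0 : 0 < A := by positivity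
  set t := max (1 - Real.exp (-A)) (r ^ 2) with htd
  have ht : t ∈ Set.Ioo (0:ℝ) 1 := ⟨r1.1.trans_le (le_max_right _ _),
    max_lt (by linarith [Real.exp_pos (-A)]) r1.2⟩
  have hst : Real.sqrt t ∈ Set.Ioo (0:ℝ) 1 :=
    ⟨Real.sqrt_pos.2 ht.1, by rw [Real.sqrt_lt' one_pos]; simpa using ht.2⟩
  have hrs : r ≤ Real.sqrt t := Real.le_sqrt_of_sq_le (le_max_right _ _)
  have hlog : A ≤ -Real.log (1 - t) := by
    have : Real.log (1 - t) ≤ Real.log (Real.exp (-A)) :=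
      Real.log_le_log (by linarith [ht.2]) (by linarith [le_max_left (1 - Real.exp (-A)) (r ^ 2)])
    rw [Real.log_exp] at this
    linarith
  have hle : muFn a (Real.sqrt t) ≤ y := by
    rw [muFn_eq hst, Real.sq_sqrt ht.1.le, ← mul_div_assoc, div_le_iff₀ (hF_pos ha ha' ht)]
    have m : hF a (1 - t) ≤ hF a (1 - r ^ 2) :=
      (hF_strictMono ha ha').monotoneOn ⟨by linarith [ht.2], by linarith [ht.1]⟩ ⟨r2.1.le, r2.2⟩
        (by linarith [le_max_right (1 - Real.exp (-A)) (r ^ 2)])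
    have l := hF_lower ha ha' ⟨ht.1.le, ht.2⟩
    calc k * hF a (1 - t) ≤ k * hF a (1 - r ^ 2) := by gcongr
      _ = y * (a * (1 - a) * A) := by rw [hA, mul_div_cancel₀ _ hb.ne', mul_div_cancel₀ _ hy.ne']
      _ ≤ y * (a * (1 - a) * (-Real.log (1 - t))) := by gcongr
      _ ≤ y * hF a t := by gcongr
  have hsub : Set.Icc r (Real.sqrt t) ⊆ Set.Ioo (0:ℝ) 1 := fun z hz =>
    ⟨hr.1.trans_le hz.1, hz.2.trans_lt hst.2⟩
  obtain ⟨s, hs, e⟩ := intermediate_value_Icc' hrs ((muFn_cont ha ha').mono hsub) ⟨hle, hyr⟩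
  exact ⟨s, hsub hs, e⟩

lemma phiK_spec {K r : ℝ} (hK : 1 ≤ K) (hr : r ∈ Set.Ioo (0:ℝ) 1) :
    phiK a K r ∈ Set.Ioo (0:ℝ) 1 ∧ muFn a (phiK a K r) = muFn a r / K := by
  have hm := muFn_pos ha ha' hr
  have hK0 : 0 < K := by linarith
  have := muFn_exists ha ha' hr (div_pos hm hK0) (div_le_self hm.le hK)
  exact ⟨Function.invFunOn_mem this, Function.invFunOn_eq this⟩

lemma phiK_pow {K p r : ℝ} (hK : 1 ≤ K) (hp : 1 ≤ p) (hr : r ∈ Set.Ioo (0:ℝ) 1) :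
    phiK a K (r ^ p) ≤ (phiK a K r) ^ p := by
  have hp0 : 0 < p := by linarith
  have hK0 : 0 < K := by linarith
  have hpm : ∀ z ∈ Set.Ioo (0:ℝ) 1, z ^ p ∈ Set.Ioo (0:ℝ) 1 := fun z hz =>
    ⟨Real.rpow_pos_of_pos hz.1 p, Real.rpow_lt_one hz.1.le hz.2 hp0⟩
  obtain ⟨hs, es⟩ := phiK_spec ha ha' hK hr
  obtain ⟨hs', es'⟩ := phiK_spec ha ha' hK (hpm r hr)
  set s := phiK a K r
  set s' := phiK a K (r ^ p)
  set Q : ℝ → ℝ := fun x => Real.log (hF a (1 - Real.exp (-x))) - Real.log (hF a (Real.exp (-x))) with hQ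
  have hk := muConst_pos ha ha'
  have hlog : ∀ z ∈ Set.Ioo (0:ℝ) 1, Real.log (muFn a z) =
      Real.log (Real.pi / (2 * Real.sin (Real.pi * a))) + Q (-(2 * Real.log z)) := by
    intro z hz
    obtain ⟨z1, z2⟩ := sq_mem hz
    have e : Real.exp (-(-(2 * Real.log z))) = z ^ 2 := by
      rw [neg_neg, ← Real.log_rpow hz.1, Real.exp_log (by positivity [hz.1])]; norm_cast
    have h1 := hF_pos ha ha' z1
    have h2 := hF_pos ha ha' z2
    simp only [hQ, e]
    rw [muFn_eq hz, Real.log_mul hk.ne' (div_pos h2 h1).ne', Real.log_div h2.ne' h1.ne']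
  have hrs : r ≤ s := by
    rw [← (muFn_anti ha ha').le_iff_ge hs hr, es]
    exact div_le_self (muFn_pos ha ha' hr).le hK
  rw [← (muFn_anti ha ha').le_iff_ge (hpm s hs) hs', es',
    ← Real.log_le_log_iff (muFn_pos ha ha' (hpm s hs)) (div_pos (muFn_pos ha ha' (hpm r hr)) hK0),
    Real.log_div (muFn_pos ha ha' (hpm r hr)).ne' hK0.ne', hlog _ (hpm s hs), hlog _ (hpm r hr),
    Real.log_rpow hs.1, Real.log_rpow hr.1]
  have e2 := congrArg Real.log es
  rw [Real.log_div (muFn_pos ha ha' hr).ne' hK0.ne', hlog _ hs, hlog _ hr] at e2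
  have := logmod_ineq ha ha' hp (y := -(2 * Real.log s)) (x := -(2 * Real.log r))
    (by linarith [Real.log_neg hs.1 hs.2]) (by linarith [Real.log_le_log hr.1 hrs]) Q hQ
  have a1 : p * -(2 * Real.log s) = -(2 * (p * Real.log s)) := by ring
  have a2 : p * -(2 * Real.log r) = -(2 * (p * Real.log r)) := by ring
  rw [a1, a2] at this
  linarith

end

lemma tanh_add_mono {x y u v : ℝ} (hx : 0 < x) (hy : 0 < y) (hxu : x ≤ u) (hyv : y ≤ v)
    (hu : u < 1) (hv : v < 1) : (x + y) / (1 + x * y) ≤ (u + v) / (1 + u * v) := by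
  have hu0 := hx.trans_le hxu
  have hv0 := hy.trans_le hyv
  have h1 : (x + y) / (1 + x * y) ≤ (u + y) / (1 + u * y) := by
    rw [div_le_div_iff₀ (by positivity) (by positivity)]
    nlinarith [mul_nonneg (sub_nonneg.2 hxu) (by nlinarith : 0 ≤ 1 - y ^ 2)]
  have h2 : (u + y) / (1 + u * y) ≤ (u + v) / (1 + u * v) := by
    rw [div_le_div_iff₀ (by positivity) (by positivity)]
    nlinarith [mul_nonneg (sub_nonneg.2 hyv) (by nlinarith : 0 ≤ 1 - u ^ 2)]
  exact h1.trans h2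

theorem stmt8 (a : ℝ) (ha : a ∈ Set.Ioc (0:ℝ) (1/2)) (K p : ℝ)
    (hK : 1 ≤ K) (hp : 1 ≤ p)
    (r s : ℝ) (hr : r ∈ Set.Ioo (0:ℝ) 1) (hs : s ∈ Set.Ioo (0:ℝ) 1) :
    ((phiK a K (r ^ p)) ^ (1 / p) + (phiK a K (s ^ p)) ^ (1 / p)) /
        (1 + (phiK a K (r ^ p)) ^ (1 / p) * (phiK a K (s ^ p)) ^ (1 / p)) ≤
      (phiK a K r + phiK a K s) / (1 + phiK a K r * phiK a K s) ∧
    (phiK a K r + phiK a K s) / (1 + phiK a K r * phiK a K s) ≤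
      ((phiK a K (r ^ (1 / p))) ^ p + (phiK a K (s ^ (1 / p))) ^ p) /
        (1 + (phiK a K (r ^ (1 / p)) * phiK a K (s ^ (1 / p))) ^ p) := by
  have ha0 := ha.1
  have ha1 : a < 1 := by linarith [ha.2]
  have hp0 : 0 < p := by linarith
  have hip : 0 < 1 / p := by positivity
  have mem : ∀ q : ℝ, 0 < q → ∀ z ∈ Set.Ioo (0:ℝ) 1, z ^ q ∈ Set.Ioo (0:ℝ) 1 := fun q hq z hz =>
    ⟨Real.rpow_pos_of_pos hz.1 q, Real.rpow_lt_one hz.1.le hz.2 hq⟩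
  have hph : ∀ z ∈ Set.Ioo (0:ℝ) 1, phiK a K z ∈ Set.Ioo (0:ℝ) 1 := fun z hz =>
    (phiK_spec ha0 ha1 hK hz).1
  have A : ∀ z ∈ Set.Ioo (0:ℝ) 1, (phiK a K (z ^ p)) ^ (1 / p) ≤ phiK a K z := by
    intro z hz
    have h := Real.rpow_le_rpow (hph _ (mem p hp0 z hz)).1.le (phiK_pow ha0 ha1 hK hp hz) hip.le
    rwa [← Real.rpow_mul (hph z hz).1.le, mul_one_div_cancel hp0.ne', Real.rpow_one] at h
  have B : ∀ z ∈ Set.Ioo (0:ℝ) 1, phiK a K z ≤ (phiK a K (z ^ (1 / p))) ^ p := by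
    intro z hz
    have h := phiK_pow ha0 ha1 hK hp (mem _ hip z hz)
    rwa [← Real.rpow_mul hz.1.le, one_div_mul_cancel hp0.ne', Real.rpow_one] at h
  constructor
  · exact tanh_add_mono (mem _ hip _ (hph _ (mem p hp0 r hr))).1
      (mem _ hip _ (hph _ (mem p hp0 s hs))).1 (A r hr) (A s hs) (hph r hr).2 (hph s hs).2
  · have m1 := hph _ (mem _ hip r hr)
    have m2 := hph _ (mem _ hip s hs)
    rw [Real.mul_rpow m1.1.le m2.1.le]
    exact tanh_add_mono (hph r hr).1 (hph s hs).1 (B r hr) (B s hs)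
      (mem _ hp0 _ m1).2 (mem _ hp0 _ m2).2
end
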